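/- arXiv:1210.5991 — 3 statements merged into one kernel-verified Lean document; each statement's English description precedes it below -/
import Mathlib

section
/- Let Φ ∈ ℝ^{M×N} satisfy the restricted isometry property of order s with constant δ ∈ (0,1). Then for all disjoint index sets I, J ⊆ {1,…,N} with |I| + |J| ≤ s and every vector z ∈ ℝ^N with supp(z) ⊆ J, one has ‖(ΦᵀΦz)|_I‖₂ ≤ δ·‖z‖₂. -/
open Finset

/-- The Euclidean (ℓ²) norm of a vector in ℝⁿ. -/
noncomputable def l2norm {n : ℕ} (v : Fin n → ℝ) : ℝ := Real.sqrt (∑ i, v i ^ 2)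

/-- The Euclidean inner product on ℝᵐ. -/
noncomputable def dot {m : ℕ} (u v : Fin m → ℝ) : ℝ := ∑ k, u k * v k

/-- `x` has at most `s` nonzero entries. -/
noncomputable def sparse {n : ℕ} (s : ℕ) (x : Fin n → ℝ) : Prop :=
  (Finset.univ.filter (fun i => x i ≠ 0)).card ≤ s

/-- `Φ` satisfies the restricted isometry property of order `s` with constant `δ`. -/
noncomputable def RIP {M N : ℕ} (Φ : Matrix (Fin M) (Fin N) ℝ) (s : ℕ) (δ : ℝ) : Prop :=
  ∀ x : Fin N → ℝ, sparse s x →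
    (1 - δ) * l2norm x ^ 2 ≤ l2norm (Φ.mulVec x) ^ 2 ∧
    l2norm (Φ.mulVec x) ^ 2 ≤ (1 + δ) * l2norm x ^ 2

lemma l2norm_sq {n : ℕ} (v : Fin n → ℝ) : l2norm v ^ 2 = ∑ i, v i ^ 2 := by
  unfold l2norm
  exact Real.sq_sqrt (Finset.sum_nonneg fun i _ => sq_nonneg _)

lemma sparse_of_support {n s : ℕ} (I J : Finset (Fin n)) (hcard : I.card + J.card ≤ s)
    (x : Fin n → ℝ) (hx : ∀ i, x i ≠ 0 → i ∈ I ∪ J) : sparse s x := by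
  unfold sparse
  refine le_trans (Finset.card_le_card (t := I ∪ J) ?_) ((Finset.card_union_le I J).trans hcard)
  intro i hi
  exact hx i (by simpa using hi)

/-- Lemma 2, Lemma 1 in [Dai & Milenkovic]:
if `Φ` has RIP of order `s` with constant `δ ∈ (0,1)`, `I` and `J` are disjoint index
sets with `|I| + |J| ≤ s` and `z` is supported on `J`, then `‖(ΦᵀΦz)|_I‖₂ ≤ δ‖z‖₂`. -/
theorem stmt_1 {M N s : ℕ} (Φ : Matrix (Fin M) (Fin N) ℝ) (δ : ℝ)
    (hδ0 : 0 < δ) (hδ1 : δ < 1) (hRIP : RIP Φ s δ)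
    (I J : Finset (Fin N)) (hIJ : Disjoint I J) (hcard : I.card + J.card ≤ s)
    (z : Fin N → ℝ) (hz : ∀ i, z i ≠ 0 → i ∈ J) :
    l2norm (fun i => if i ∈ I then Φ.transpose.mulVec (Φ.mulVec z) i else 0) ≤
      δ * l2norm z := by
  set w : Fin N → ℝ := fun i => if i ∈ I then Φ.transpose.mulVec (Φ.mulVec z) i else 0 with hw
  have hwI : ∀ i, i ∉ I → w i = 0 := fun i hi => by simp [hw, hi]
  have hzJ : ∀ i, i ∉ J → z i = 0 := fun i hi => by
    by_contra h
    exact hi (hz i h)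
  have hwz : ∀ i, w i * z i = 0 := fun i => by
    by_cases hi : i ∈ I
    · rw [hzJ i (Finset.disjoint_left.mp hIJ hi), mul_zero]
    · rw [hwI i hi, zero_mul]
  have hsp : ∀ c : ℝ, sparse s (δ⁻¹ • w + c • z) := fun c => by
    apply sparse_of_support I J hcard
    intro i hi
    by_contra h
    rw [Finset.mem_union, not_or] at h
    exact hi (by simp [hwI i h.1, hzJ i h.2])
  have hn : ∀ c : ℝ, l2norm (δ⁻¹ • w + c • z) ^ 2
      = δ⁻¹ ^ 2 * l2norm w ^ 2 + c ^ 2 * l2norm z ^ 2 := fun c => by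
    simp only [l2norm_sq, Finset.mul_sum, ← Finset.sum_add_distrib]
    refine Finset.sum_congr rfl fun i _ => ?_
    simp only [Pi.add_apply, Pi.smul_apply, smul_eq_mul]
    linear_combination 2 * δ⁻¹ * c * hwz i
  have hinner : ∑ k, Φ.mulVec w k * Φ.mulVec z k = l2norm w ^ 2 := by
    have h1 : ∑ k, Φ.mulVec w k * Φ.mulVec z k
        = ∑ i, w i * Φ.transpose.mulVec (Φ.mulVec z) i := by
      change Φ.mulVec w ⬝ᵥ Φ.mulVec z = w ⬝ᵥ Φ.transpose.mulVec (Φ.mulVec z)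
      rw [Matrix.mulVec_transpose, dotProduct_comm, Matrix.dotProduct_mulVec, dotProduct_comm]
    rw [h1, l2norm_sq]
    refine Finset.sum_congr rfl fun i _ => ?_
    by_cases hi : i ∈ I
    · simp [hw, hi, sq]
    · simp [hwI i hi]
  have hP : ∀ c : ℝ, l2norm (Φ.mulVec (δ⁻¹ • w + c • z)) ^ 2
      = δ⁻¹ ^ 2 * l2norm (Φ.mulVec w) ^ 2 + c ^ 2 * l2norm (Φ.mulVec z) ^ 2
        + 2 * δ⁻¹ * c * l2norm w ^ 2 := fun c => by
    rw [← hinner]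
    simp only [l2norm_sq, Finset.mul_sum, ← Finset.sum_add_distrib]
    refine Finset.sum_congr rfl fun i _ => ?_
    simp only [Matrix.mulVec_add, Matrix.mulVec_smul, Pi.add_apply, Pi.smul_apply, smul_eq_mul]
    ring
  have h1 := (hRIP _ (hsp 1)).2
  have h2 := (hRIP _ (hsp (-1))).1
  rw [hP, hn] at h1 h2
  have h3 : 2 * (δ⁻¹ * l2norm w ^ 2) ≤ δ * (δ⁻¹ ^ 2 * l2norm w ^ 2 + l2norm z ^ 2) := by
    linarith
  have h4 : δ * (δ⁻¹ ^ 2 * l2norm w ^ 2 + l2norm z ^ 2)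
      = δ⁻¹ * l2norm w ^ 2 + δ * l2norm z ^ 2 := by
    field_simp
  have h5 : δ⁻¹ * l2norm w ^ 2 ≤ δ * l2norm z ^ 2 := by linarith
  have h6 : l2norm w ^ 2 ≤ (δ * l2norm z) ^ 2 := by
    have := mul_le_mul_of_nonneg_left h5 hδ0.le
    rw [mul_inv_cancel_left₀ hδ0.ne'] at this
    linarith
  exact (abs_le_of_sq_le_sq' h6 (mul_nonneg hδ0.le (Real.sqrt_nonneg _))).2
end

section
/- Let c and r be positive integers and let Φ ∈ ℝ^{M×N} satisfy the restricted isometry property of order 2r with constant δ ∈ (0,1). Then for every x ∈ ℝ^N with at most c·r nonzero entries, (1−cδ)·‖x‖₂² ≤ ‖Φx‖₂² ≤ (1+cδ)·‖x‖₂². -/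
open Finset

lemma aux_color {N : ℕ} (S : Finset (Fin N)) (c r : ℕ) (hr : 0 < r) (hS : S.card ≤ c * r) :
    ∃ f : Fin N → ℕ, (∀ i ∈ S, f i < c) ∧ ∀ k, (S.filter (fun i => f i = k)).card ≤ r := by
  have hlt : ∀ i ∈ S, ∀ j, i < j → (S.filter (· < i)).card < (S.filter (· < j)).card := by
    intro i hi j hij
    apply Finset.card_lt_card
    rw [Finset.ssubset_iff_of_subset]
    · exact ⟨i, by simp [hi, hij], by simp⟩
    · intro a ha
      simp only [Finset.mem_filter] at ha ⊢
      exact ⟨ha.1, ha.2.trans hij⟩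
  refine ⟨fun i => (S.filter (· < i)).card / r, ?_, ?_⟩
  · intro i hi
    apply Nat.div_lt_of_lt_mul
    have : (S.filter (· < i)).card < S.card := by
      apply Finset.card_lt_card
      rw [Finset.ssubset_iff_of_subset (Finset.filter_subset _ _)]
      exact ⟨i, hi, by simp⟩
    rw [mul_comm]
    omega
  · intro k
    have h : (S.filter (fun i => (S.filter (· < i)).card / r = k)).card
        ≤ (Finset.Ico (k * r) (k * r + r)).card := by
      apply Finset.card_le_card_of_injOn (fun i => (S.filter (· < i)).card)
      · intro i hi
        simp only [Finset.coe_filter, Set.mem_ofPred_eq] at hi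
        have h1 := Nat.div_add_mod (S.filter (· < i)).card r
        have h2 := Nat.mod_lt (S.filter (· < i)).card hr
        rw [hi.2, mul_comm] at h1
        simp only [Finset.coe_Ico, Set.mem_Ico]
        omega
      · intro i hi j hj hij
        simp only [Finset.coe_filter, Set.mem_ofPred_eq] at hi hj hij
        rcases lt_trichotomy i j with h | h | h
        · have := hlt i hi.1 j h
          omega
        · exact h
        · have := hlt j hj.1 i h
          omega
    simpa using h

lemma aux_l2 {n : ℕ} (v : Fin n → ℝ) : l2norm v ^ 2 = v ⬝ᵥ v := by
  unfold l2norm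
  rw [Real.sq_sqrt (Finset.sum_nonneg fun i _ => sq_nonneg _)]
  simp [dotProduct, sq]

/-- The deviation bilinear form. -/
noncomputable def auxB {M N : ℕ} (Φ : Matrix (Fin M) (Fin N) ℝ) :
    (Fin N → ℝ) →ₗ[ℝ] (Fin N → ℝ) →ₗ[ℝ] ℝ :=
  LinearMap.mk₂ ℝ (fun u v => (Φ.mulVec u) ⬝ᵥ (Φ.mulVec v) - u ⬝ᵥ v)
    (by intro a b d; simp only [Matrix.mulVec_add, add_dotProduct]; ring)
    (by intro a b d; simp only [Matrix.mulVec_smul, smul_dotProduct, smul_eq_mul]; ring)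
    (by intro a b d; simp only [Matrix.mulVec_add, dotProduct_add]; ring)
    (by intro a b d; simp only [Matrix.mulVec_smul, dotProduct_smul, smul_eq_mul]; ring)

lemma auxB_apply {M N : ℕ} (Φ : Matrix (Fin M) (Fin N) ℝ) (u v : Fin N → ℝ) :
    auxB Φ u v = (Φ.mulVec u) ⬝ᵥ (Φ.mulVec v) - u ⬝ᵥ v := rfl

lemma auxB_diag {M N : ℕ} (Φ : Matrix (Fin M) (Fin N) ℝ) (s : ℕ) (δ : ℝ) (h : RIP Φ s δ)
    (u : Fin N → ℝ) (hu : sparse s u) : |auxB Φ u u| ≤ δ * (u ⬝ᵥ u) := by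
  have := h u hu
  rw [aux_l2, aux_l2] at this
  rw [auxB_apply, abs_le]
  constructor <;> linarith [this.1, this.2]

lemma auxB_cross {M N : ℕ} (Φ : Matrix (Fin M) (Fin N) ℝ) (s : ℕ) (δ : ℝ) (h : RIP Φ s δ)
    (u v : Fin N → ℝ) (hp : sparse s (u + v)) (hm : sparse s (u - v)) :
    |auxB Φ u v| ≤ δ * (u ⬝ᵥ u + v ⬝ᵥ v) / 2 := by
  have h1 := auxB_diag Φ s δ h _ hp
  have h2 := auxB_diag Φ s δ h _ hm
  have hs : auxB Φ v u = auxB Φ u v := by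
    rw [auxB_apply, auxB_apply, dotProduct_comm, dotProduct_comm v u]
  have hd : v ⬝ᵥ u = u ⬝ᵥ v := dotProduct_comm _ _
  simp only [map_add, map_sub, LinearMap.add_apply, LinearMap.sub_apply, hs, add_dotProduct,
    dotProduct_add, sub_dotProduct, dotProduct_sub, hd] at h1 h2
  rw [abs_le] at *
  constructor <;> linarith [h1.1, h1.2, h2.1, h2.2]

/-- Corollary 3.4 in [Needell & Tropp]: if `c, r` are positive integers and
`Φ` has RIP of order `2r` with constant `δ ∈ (0,1)`, then the RIP inequalities of order
`c·r` hold with constant `c·δ`. -/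
theorem stmt_2 {M N : ℕ} (c r : ℕ) (hc : 0 < c) (hr : 0 < r)
    (Φ : Matrix (Fin M) (Fin N) ℝ) (δ : ℝ)
    (hδ0 : 0 < δ) (hδ1 : δ < 1) (hRIP : RIP Φ (2 * r) δ) :
    ∀ x : Fin N → ℝ, sparse (c * r) x →
      (1 - c * δ) * l2norm x ^ 2 ≤ l2norm (Φ.mulVec x) ^ 2 ∧
      l2norm (Φ.mulVec x) ^ 2 ≤ (1 + c * δ) * l2norm x ^ 2 := by
  intro x hx
  obtain ⟨f, hf, hk⟩ := aux_color _ c r hr hx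
  set b : ℕ → Fin N → ℝ := fun k i => if f i = k then x i else 0 with hb
  have hxs : x = ∑ k ∈ range c, b k := by
    funext i
    rw [Finset.sum_apply]
    by_cases h0 : x i = 0
    · simp [hb, h0]
    · have := hf i (by simp [h0])
      simp [hb, this]
  have hsp : ∀ k l (w : Fin N → ℝ), (∀ i, b k i = 0 → b l i = 0 → w i = 0) →
      sparse (2 * r) w := by
    intro k l w hw
    unfold sparse
    have : univ.filter (fun i => w i ≠ 0) ⊆
        ((univ.filter (fun i => x i ≠ 0)).filter (fun i => f i = k)) ∪
        ((univ.filter (fun i => x i ≠ 0)).filter (fun i => f i = l)) := by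
      intro i hi
      simp only [mem_filter, mem_univ, true_and, mem_union] at hi ⊢
      by_contra hcon
      apply hi
      apply hw <;> simp only [hb] <;> split_ifs <;> tauto
    have h1 := Finset.card_le_card this
    have h2 := Finset.card_union_le
      ((univ.filter (fun i => x i ≠ 0)).filter (fun i => f i = k))
      ((univ.filter (fun i => x i ≠ 0)).filter (fun i => f i = l))
    have h3 := hk k
    have h4 := hk l
    omega
  have hB : ∀ k l, |auxB Φ (b k) (b l)| ≤ δ * (b k ⬝ᵥ b k + b l ⬝ᵥ b l) / 2 := by
    intro k l
    apply auxB_cross Φ (2 * r) δ hRIP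
    · exact hsp k l _ (by intro i h1 h2; simp [h1, h2])
    · exact hsp k l _ (by intro i h1 h2; simp [h1, h2])
  have hn : ∑ k ∈ range c, b k ⬝ᵥ b k = x ⬝ᵥ x := by
    simp only [dotProduct]
    rw [Finset.sum_comm]
    apply Finset.sum_congr rfl
    intro i _
    by_cases h0 : x i = 0
    · simp [hb, h0]
    · have := hf i (by simp [h0])
      simp [hb, this]
  have hmain : |auxB Φ x x| ≤ c * δ * (x ⬝ᵥ x) := by
    have e : auxB Φ x x = ∑ k ∈ range c, ∑ l ∈ range c, auxB Φ (b k) (b l) := by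
      conv_lhs => rw [hxs]
      simp only [map_sum, LinearMap.sum_apply]
      rw [Finset.sum_comm]
    rw [e]
    calc _ ≤ ∑ k ∈ range c, ∑ l ∈ range c, δ * (b k ⬝ᵥ b k + b l ⬝ᵥ b l) / 2 := by
          refine (Finset.abs_sum_le_sum_abs _ _).trans (Finset.sum_le_sum fun k _ => ?_)
          exact (Finset.abs_sum_le_sum_abs _ _).trans (Finset.sum_le_sum fun l _ => hB k l)
      _ = c * δ * (x ⬝ᵥ x) := by
          simp only [← Finset.sum_div, ← Finset.mul_sum, Finset.sum_add_distrib, hn,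
            Finset.sum_const, card_range, nsmul_eq_mul]
          ring
  rw [auxB_apply, abs_le] at hmain
  rw [aux_l2, aux_l2]
  constructor <;> linarith [hmain.1, hmain.2]
end

section
/- Let Φ ∈ ℝ^{M×N} satisfy the restricted isometry property of order s with constant δ ∈ (0,1). Let T, S ⊆ {1,…,N} with T ∖ S nonempty and |T ∪ S| ≤ s, let z ∈ ℝ^N be supported on T ∪ S, and set r = Φz. If ⟨φ_i, r⟩ = 0 for every i ∈ S, then max_{i ∈ T ∪ S} |⟨φ_i, r⟩| ≥ ((1 − δ)/√|T ∖ S|) · ‖z‖₂. -/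
open Finset

/-- if `Φ` has RIP of order `s` with constant `δ ∈ (0,1)`, `T ∖ S ≠ ∅`,
`|T ∪ S| ≤ s`, `z` is supported on `T ∪ S`, `r = Φz`, and `⟨φ_i, r⟩ = 0` for all `i ∈ S`,
then `max_{i ∈ T ∪ S} |⟨φ_i, r⟩| ≥ ((1−δ)/√|T∖S|) ‖z‖₂`. -/
theorem stmt_10 {M N s : ℕ} (Φ : Matrix (Fin M) (Fin N) ℝ) (δ : ℝ)
    (hδ0 : 0 < δ) (hδ1 : δ < 1) (hRIP : RIP Φ s δ)
    (T S : Finset (Fin N)) (hne : (T \ S).Nonempty) (hcard : (T ∪ S).card ≤ s)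
    (z : Fin N → ℝ) (hz : ∀ i, z i ≠ 0 → i ∈ T ∪ S)
    (r : Fin M → ℝ) (hr : r = Φ.mulVec z)
    (horth : ∀ i ∈ S, dot (fun k => Φ k i) r = 0) :
    (1 - δ) / Real.sqrt ((T \ S).card) * l2norm z ≤
      (T ∪ S).sup'
        (by obtain ⟨a, ha⟩ := hne
            exact ⟨a, Finset.mem_union_left _ (Finset.mem_sdiff.mp ha).1⟩)
        (fun i => |dot (fun k => Φ k i) r|) := by
  generalize_proofs hU
  set g : Fin N → ℝ := fun i => dot (fun k => Φ k i) r with hg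
  set m := (T ∪ S).sup' hU (fun i => |g i|) with hm
  have hgm : ∀ i ∈ T ∪ S, |g i| ≤ m := fun i hi =>
    Finset.le_sup' (fun i => |g i|) hi
  have hm0 : 0 ≤ m := by
    obtain ⟨a, ha⟩ := hU
    exact le_trans (abs_nonneg _) (hgm a ha)
  have hsp : sparse s z := by
    unfold sparse
    refine le_trans (Finset.card_le_card ?_) hcard
    intro i hi
    exact hz i (Finset.mem_filter.mp hi).2
  have h1 := (hRIP z hsp).1
  rw [← hr] at h1
  have hsq : ∀ {n : ℕ} (v : Fin n → ℝ), l2norm v ^ 2 = ∑ i, v i ^ 2 := fun v =>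
    Real.sq_sqrt (Finset.sum_nonneg fun i _ => sq_nonneg _)
  have hn0 : 0 ≤ l2norm z := Real.sqrt_nonneg _
  have h2 : l2norm r ^ 2 = ∑ i, z i * g i := by
    rw [hsq]
    simp only [hg, dot, Finset.mul_sum]
    rw [Finset.sum_comm]
    refine Finset.sum_congr rfl fun k _ => ?_
    have hk : r k = ∑ i, Φ k i * z i := by rw [hr]; rfl
    rw [sq]
    nth_rewrite 1 [hk]
    rw [Finset.sum_mul]
    exact Finset.sum_congr rfl fun i _ => by ring
  have h3 : ∑ i, z i * g i = ∑ i ∈ T \ S, z i * g i := by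
    symm
    refine Finset.sum_subset (Finset.subset_univ _) fun i _ hi => ?_
    by_cases hS : i ∈ S
    · have : g i = 0 := horth i hS
      rw [this, mul_zero]
    · have : z i = 0 := by
        by_contra h
        rcases Finset.mem_union.mp (hz i h) with h' | h'
        · exact hi (Finset.mem_sdiff.mpr ⟨h', hS⟩)
        · exact hS h'
      rw [this, zero_mul]
  have h4 : ∑ i ∈ T \ S, z i * g i ≤ (∑ i ∈ T \ S, |z i|) * m := by
    rw [Finset.sum_mul]
    refine Finset.sum_le_sum fun i hi => ?_
    calc z i * g i ≤ |z i * g i| := le_abs_self _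
      _ = |z i| * |g i| := abs_mul _ _
      _ ≤ |z i| * m := mul_le_mul_of_nonneg_left
        (hgm i (Finset.mem_union_left _ (Finset.mem_sdiff.mp hi).1)) (abs_nonneg _)
  have hc : 0 < Real.sqrt ((T \ S).card) :=
    Real.sqrt_pos.mpr (by exact_mod_cast hne.card_pos)
  have h5 : ∑ i ∈ T \ S, |z i| ≤ Real.sqrt ((T \ S).card) * l2norm z := by
    refine abs_le_of_sq_le_sq' ?_ (mul_nonneg hc.le hn0) |>.2
    rw [mul_pow, Real.sq_sqrt (Nat.cast_nonneg _), hsq]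
    refine le_trans sq_sum_le_card_mul_sum_sq ?_
    refine mul_le_mul_of_nonneg_left ?_ (Nat.cast_nonneg _)
    simp only [sq_abs]
    exact Finset.sum_le_sum_of_subset_of_nonneg (Finset.subset_univ _)
      fun i _ _ => sq_nonneg _
  have h6 : (1 - δ) * l2norm z ^ 2 ≤ Real.sqrt ((T \ S).card) * l2norm z * m :=
    calc _ ≤ _ := h1
      _ ≤ (∑ i ∈ T \ S, |z i|) * m := by rw [h2, h3]; exact h4
      _ ≤ _ := mul_le_mul_of_nonneg_right h5 hm0
  rcases hn0.eq_or_lt with h0 | h0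
  · rw [← h0, mul_zero]; exact hm0
  · rw [div_mul_eq_mul_div, div_le_iff₀ hc]
    refine le_of_mul_le_mul_right ?_ h0
    nlinarith [h6]
end
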